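/- Let V and V' be finite types, each with at least 2 elements, let k be a real number, and let A (indexed by V×V) and A' (indexed by V'×V') be real symmetric matrices with nonnegative entries whose every row sum equals k and whose supports are connected. Suppose f : V' → V is surjective and for every v' ∈ V' and w ∈ V, Σ_{w' ∈ f⁻¹(w)} A' v' w' = A (f v') w. Then sSup{μ : μ is an eigenvalue of A' and μ ≠ k} ≥ sSup{μ : μ is an eigenvalue of A and μ ≠ k}. -/

import Mathlib

/-- The eigenvalues of a real square matrix are bounded above. -/
theorem bddAbove_eigenvalues {n : Type*} [Fintype n] (M : Matrix n n ℝ) :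
    BddAbove {μ : ℝ | ∃ x : n → ℝ, x ≠ 0 ∧ M.mulVec x = μ • x} := by
  have hfin : {μ | Module.End.HasEigenvalue M.mulVecLin μ}.Finite :=
    Module.End.finite_hasEigenvalue _
  refine hfin.bddAbove.mono ?_
  rintro μ ⟨x, hx, h⟩
  exact Module.End.hasEigenvalue_of_hasEigenvector
    (x := x) ⟨Module.End.mem_eigenspace_iff.mpr (by simpa using h), hx⟩

/-- A real symmetric matrix that is not the scalar matrix `k` has an eigenvalue different
from `k`. -/
theorem exists_eigenvalue_ne {n : Type*} [Fintype n] [DecidableEq n] {M : Matrix n n ℝ}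
    (hM : M.IsSymm) {k : ℝ} (hk : M ≠ k • 1) :
    ∃ μ : ℝ, (∃ x : n → ℝ, x ≠ 0 ∧ M.mulVec x = μ • x) ∧ μ ≠ k := by
  have hH : M.IsHermitian := by simpa [Matrix.IsHermitian] using hM.eq
  by_contra! hall
  refine hk ?_
  have hmul (i : n) : M.mulVec (hH.eigenvectorBasis i).ofLp =
      hH.eigenvalues i • (hH.eigenvectorBasis i).ofLp := hH.mulVec_eigenvectorBasis i
  have heig (i : n) : hH.eigenvalues i = k := by
    refine hall _ ⟨(hH.eigenvectorBasis i).ofLp, ?_, hmul i⟩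
    simpa using hH.eigenvectorBasis.orthonormal.ne_zero i
  have hlin : Matrix.toEuclideanLin M = k • LinearMap.id := by
    refine hH.eigenvectorBasis.toBasis.ext fun i => ?_
    apply WithLp.ofLp_injective
    simpa [heig i] using hmul i
  apply Matrix.toEuclideanLin.injective
  rw [hlin]
  ext x i
  simp

/-- A relation joining two distinct points by a chain relates some two distinct points. -/
theorem exists_ne_of_chain {α : Type*} {r : α → α → Prop} {m : ℕ} {c : Fin (m + 1) → α}
    (hc : ∀ t : Fin m, r (c t.castSucc) (c t.succ)) (hne : c 0 ≠ c (Fin.last m)) :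
    ∃ a b, a ≠ b ∧ r a b := by
  by_contra! h
  have hconst (t : Fin (m + 1)) : c 0 = c t := by
    induction t using Fin.induction with
    | zero => rfl
    | succ t ih =>
      rw [ih]
      by_contra hstep
      exact h _ _ hstep (hc t)
  exact hne (hconst _)

/-- Pulling back along a covering intertwines the adjacency operators. -/
theorem mulVec_comp_of_covering {V V' R : Type*} [Fintype V] [Fintype V'] [DecidableEq V]
    [NonUnitalNonAssocSemiring R] {A : Matrix V V R} {A' : Matrix V' V' R} {f : V' → V}
    (hcov : ∀ (v' : V') (w : V),
      ∑ w' ∈ Finset.univ.filter (fun w' => f w' = w), A' v' w' = A (f v') w) (x : V → R) :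
    A'.mulVec (x ∘ f) = A.mulVec x ∘ f := by
  ext v'
  simp only [Matrix.mulVec, dotProduct, Function.comp_apply, ← hcov, Finset.sum_mul]
  rw [← Finset.sum_fiberwise Finset.univ f]
  refine Finset.sum_congr rfl fun w _ => Finset.sum_congr rfl fun w' hw' => ?_
  rw [(Finset.mem_filter.mp hw').2]



theorem stmt_7 {V V' : Type*} [Fintype V] [Fintype V'] [DecidableEq V]
    (hV : 2 ≤ Fintype.card V) (hV' : 2 ≤ Fintype.card V')
    (k : ℝ)
    (A : Matrix V V ℝ) (A' : Matrix V' V' ℝ)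
    (hsymm : A.IsSymm) (hsymm' : A'.IsSymm)
    (hnonneg : ∀ i j, 0 ≤ A i j) (hnonneg' : ∀ i j, 0 ≤ A' i j)
    (hrow : ∀ i, ∑ j, A i j = k) (hrow' : ∀ i, ∑ j, A' i j = k)
    (hconn : ∀ i j : V, ∃ m : ℕ, ∃ c : Fin (m + 1) → V,
      c 0 = i ∧ c (Fin.last m) = j ∧ ∀ t : Fin m, 0 < A (c t.castSucc) (c t.succ))
    (hconn' : ∀ i j : V', ∃ m : ℕ, ∃ c : Fin (m + 1) → V',
      c 0 = i ∧ c (Fin.last m) = j ∧ ∀ t : Fin m, 0 < A' (c t.castSucc) (c t.succ))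
    (f : V' → V) (hf : Function.Surjective f)
    (hcov : ∀ (v' : V') (w : V),
      ∑ w' ∈ Finset.univ.filter (fun w' => f w' = w), A' v' w' = A (f v') w) :
    sSup {μ : ℝ | (∃ x : V → ℝ, x ≠ 0 ∧ A.mulVec x = μ • x) ∧ μ ≠ k} ≤
      sSup {μ : ℝ | (∃ x : V' → ℝ, x ≠ 0 ∧ A'.mulVec x = μ • x) ∧ μ ≠ k} := by
  apply csSup_le_csSup
  · exact (bddAbove_eigenvalues A').mono fun μ hμ => hμ.1
  · refine exists_eigenvalue_ne hsymm ?_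
    rintro rfl
    have : Nontrivial V := Fintype.one_lt_card_iff_nontrivial.mp hV
    obtain ⟨i, j, hij⟩ := exists_pair_ne V
    obtain ⟨m, c, rfl, rfl, hc⟩ := hconn i j
    obtain ⟨a, b, hab, hpos⟩ :=
      exists_ne_of_chain (r := fun a b => 0 < (k • (1 : Matrix V V ℝ)) a b) hc hij
    simp [hab] at hpos
  · rintro μ ⟨⟨x, hx, hμ⟩, hne⟩
    refine ⟨⟨x ∘ f, fun h => hx (hf.injective_comp_right h), ?_⟩, hne⟩
    rw [mulVec_comp_of_covering hcov, hμ]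
    rfl
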